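/- Let 0 < δ < r and let φ : ℝ³ \ {0} → ℝ³ be the reflection across the sphere of radius r, φ(x) = (2r/‖x‖ − 1)·x. Then for every continuously differentiable function w : ℝ³ → ℝ, ∫_{{x : r < ‖x‖ < r+δ}} ‖D(w∘φ)(x)‖² dx ≤ ((r+δ)/(r−δ))² · ∫_{{x : r−δ < ‖x‖ < r}} ‖Dw(x)‖² dx, where D denotes the Fréchet derivative, ‖·‖ its operator norm, and the integrals are with respect to Lebesgue measure on ℝ³. -/

import Mathlib

open MeasureTheory

/-- The derivative at `x ≠ 0` of the radial reflection `x ↦ (2r/‖x‖ − 1)·x`. -/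
noncomputable def radialReflectionDeriv {E : Type*} [NormedAddCommGroup E] [InnerProductSpace ℝ E]
    (r : ℝ) (x : E) : E →L[ℝ] E :=
  (2 * r / ‖x‖ - 1) • ContinuousLinearMap.id ℝ E -
    (2 * r / ‖x‖ ^ 3) • (innerSL ℝ x).smulRight x

section RadialReflection

variable {E : Type*} [NormedAddCommGroup E] [InnerProductSpace ℝ E]

lemma radialReflectionDeriv_apply (r : ℝ) (x v : E) :
    radialReflectionDeriv r x v =
      (2 * r / ‖x‖ - 1) • v - (2 * r / ‖x‖ ^ 3 * inner ℝ x v) • x := by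
  simp [radialReflectionDeriv, smul_smul]

lemma hasFDerivAt_radialReflection (r : ℝ) {x : E} (hx : x ≠ 0) :
    HasFDerivAt (fun y : E => (2 * r / ‖y‖ - 1) • y) (radialReflectionDeriv r x) x := by
  have hx' : ‖x‖ ≠ 0 := norm_ne_zero_iff.2 hx
  have hn : HasFDerivAt (fun y : E => ‖y‖) (‖x‖⁻¹ • innerSL ℝ x) x := by
    have h := (hasStrictFDerivAt_norm_sq x).hasFDerivAt.sqrt (by positivity)
    simp only [Real.sqrt_sq (norm_nonneg _)] at h
    convert h using 1
    ext v
    simp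
    field_simp
  have hc : HasFDerivAt (fun y : E => 2 * r / ‖y‖ - 1)
      ((-(2 * r) / ‖x‖ ^ 2) • (‖x‖⁻¹ • innerSL ℝ x)) x := by
    refine ((((hasDerivAt_inv hx').const_mul (2 * r)).sub_const 1).comp_hasFDerivAt x hn).congr_fderiv
      ?_
    congr 1
    ring
  refine (hc.smul (hasFDerivAt_id x)).congr_fderiv ?_
  ext v
  simp only [radialReflectionDeriv_apply, sub_eq_add_neg, ← neg_smul, FunLike.coe_add,
    FunLike.coe_smul,
    Pi.add_apply, Pi.smul_apply, ContinuousLinearMap.smulRight_apply, innerSL_apply_apply,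
    ContinuousLinearMap.id_apply, id_eq, smul_eq_mul]
  congr 2
  field_simp

lemma norm_radialReflectionDeriv_le_one {r : ℝ} {x : E} (hr : 0 < r) (hx : r ≤ ‖x‖) :
    ‖radialReflectionDeriv r x‖ ≤ 1 := by
  refine ContinuousLinearMap.opNorm_le_bound _ zero_le_one fun v => ?_
  have hs : 0 < ‖x‖ := hr.trans_le hx
  rw [one_mul, radialReflectionDeriv_apply]
  refine le_of_sq_le_sq ?_ (norm_nonneg v)
  have hcs : (inner ℝ x v) ^ 2 ≤ ‖x‖ ^ 2 * ‖v‖ ^ 2 := by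
    rw [← mul_pow]
    exact sq_le_sq.2 ((abs_real_inner_le_norm x v).trans (le_abs_self _))
  have hkey : ‖(2 * r / ‖x‖ - 1) • v - (2 * r / ‖x‖ ^ 3 * inner ℝ x v) • x‖ ^ 2 =
      ‖v‖ ^ 2 - (4 * r * (‖x‖ - r) / ‖x‖ ^ 4) * (‖x‖ ^ 2 * ‖v‖ ^ 2 - (inner ℝ x v) ^ 2) := by
    rw [norm_sub_sq_real, norm_smul, norm_smul, mul_pow, mul_pow, real_inner_smul_left,
      real_inner_smul_right, real_inner_comm x v, Real.norm_eq_abs, Real.norm_eq_abs, sq_abs,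
      sq_abs]
    field_simp
    ring
  rw [hkey]
  have h1 : 0 ≤ 4 * r * (‖x‖ - r) / ‖x‖ ^ 4 := by
    have := sub_nonneg.2 hx
    positivity
  nlinarith [mul_nonneg h1 (sub_nonneg.2 hcs)]

lemma norm_radialReflection {r : ℝ} {x : E} (hx : x ≠ 0) (hxr : ‖x‖ ≤ 2 * r) :
    ‖(2 * r / ‖x‖ - 1) • x‖ = 2 * r - ‖x‖ := by
  have hs : 0 < ‖x‖ := norm_pos_iff.2 hx
  rw [norm_smul, Real.norm_of_nonneg (by rw [sub_nonneg, le_div_iff₀ hs]; linarith)]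
  field_simp

lemma radialReflection_radialReflection {r : ℝ} {x : E} (hx : x ≠ 0) (hxr : ‖x‖ < 2 * r) :
    (2 * r / ‖(2 * r / ‖x‖ - 1) • x‖ - 1) • (2 * r / ‖x‖ - 1) • x = x := by
  have hs : 0 < ‖x‖ := norm_pos_iff.2 hx
  have ht : 2 * r - ‖x‖ ≠ 0 := (sub_pos.2 hxr).ne'
  rw [norm_radialReflection hx hxr.le, smul_smul]
  convert one_smul ℝ x using 2
  field_simp
  ring

lemma det_radialReflectionDeriv [FiniteDimensional ℝ E] (hE : Module.finrank ℝ E = 3)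
    {r : ℝ} {x : E} (hx : x ≠ 0) (hxr : ‖x‖ ≠ 2 * r) :
    (radialReflectionDeriv r x).det = -(2 * r / ‖x‖ - 1) ^ 2 := by
  have hs : ‖x‖ ≠ 0 := norm_ne_zero_iff.2 hx
  have ha : 2 * r / ‖x‖ - 1 ≠ 0 := by
    rw [sub_ne_zero, Ne, div_eq_one_iff_eq hs]
    exact hxr.symm
  set a := 2 * r / ‖x‖ - 1 with ha_def
  have h : (radialReflectionDeriv r x : E →ₗ[ℝ] E) =
      a • LinearMap.transvection ((-(2 * r / ‖x‖ ^ 3) / a) • (innerSL ℝ x : E →ₗ[ℝ] ℝ)) x := by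
    ext v
    simp [radialReflectionDeriv_apply, LinearMap.transvection.apply, smul_smul,
      sub_eq_add_neg]
    rw [← neg_smul]
    congr 1
    field_simp
  rw [ContinuousLinearMap.det, h, LinearMap.det_smul, hE, LinearMap.transvection.det]
  simp
  field_simp
  rw [ha_def]
  field_simp
  ring

end RadialReflection

/-- Bound for the global reflection operator `R₋` at a spherical interface in 3D:
with `φ(x) = (2r/‖x‖ − 1)·x` the reflection across the sphere of radius `r`, for every
`C¹` function `w` one has
`∫_{r<‖x‖<r+δ} ‖D(w∘φ)‖² ≤ ((r+δ)/(r−δ))² ∫_{r−δ<‖x‖<r} ‖Dw‖²`. -/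
theorem sphere_reflection_energy_bound_inner_to_outer (r δ : ℝ) (hδ : 0 < δ) (hδr : δ < r)
    (φ : EuclideanSpace ℝ (Fin 3) → EuclideanSpace ℝ (Fin 3))
    (hφ : ∀ x : EuclideanSpace ℝ (Fin 3), x ≠ 0 → φ x = (2 * r / ‖x‖ - 1) • x)
    (w : EuclideanSpace ℝ (Fin 3) → ℝ) (hw : ContDiff ℝ 1 w) :
    ∫ x in {x : EuclideanSpace ℝ (Fin 3) | r < ‖x‖ ∧ ‖x‖ < r + δ},
        ‖fderiv ℝ (w ∘ φ) x‖ ^ 2 ≤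
      ((r + δ) / (r - δ)) ^ 2 *
        ∫ x in {x : EuclideanSpace ℝ (Fin 3) | r - δ < ‖x‖ ∧ ‖x‖ < r},
          ‖fderiv ℝ w x‖ ^ 2 := by
  set innerShell := {x : EuclideanSpace ℝ (Fin 3) | r - δ < ‖x‖ ∧ ‖x‖ < r}
  set outerShell := {x : EuclideanSpace ℝ (Fin 3) | r < ‖x‖ ∧ ‖x‖ < r + δ}
  have hr : 0 < r := hδ.trans hδr
  have ne_zero {x : EuclideanSpace ℝ (Fin 3)} (hx : r - δ < ‖x‖) : x ≠ 0 :=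
    norm_pos_iff.1 ((sub_pos.2 hδr).trans hx)
  have h_deriv {x : EuclideanSpace ℝ (Fin 3)} (hx : x ≠ 0) :
      HasFDerivAt φ (radialReflectionDeriv r x) x :=
    (hasFDerivAt_radialReflection r hx).congr_of_eventuallyEq
      (Filter.mem_of_superset (isOpen_ne.mem_nhds hx) hφ)
  have h_norm {x : EuclideanSpace ℝ (Fin 3)} (hx : r - δ < ‖x‖) (hx' : ‖x‖ < r + δ) :
      ‖φ x‖ = 2 * r - ‖x‖ := by
    rw [hφ x (ne_zero hx), norm_radialReflection (ne_zero hx) (by linarith)]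
  have h_invol {x : EuclideanSpace ℝ (Fin 3)} (hx : r - δ < ‖x‖) (hx' : ‖x‖ < r + δ) :
      φ (φ x) = x := by
    rw [hφ (φ x) (ne_zero (by rw [h_norm hx hx']; linarith)), hφ x (ne_zero hx)]
    exact radialReflection_radialReflection (ne_zero hx) (by linarith)
  have h_image : φ '' innerShell = outerShell := by
    ext y
    constructor
    · rintro ⟨x, ⟨h1, h2⟩, rfl⟩
      have := h_norm h1 (by linarith)
      exact ⟨by linarith, by linarith⟩
    · rintro ⟨h1, h2⟩
      have := h_norm (x := y) (by linarith) h2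
      exact ⟨φ y, ⟨by linarith, by linarith⟩, h_invol (by linarith) h2⟩
  have h_inj : Set.InjOn φ innerShell := fun x hx y hy hxy => by
    rw [← h_invol hx.1 (by linarith [hx.2]), hxy, h_invol hy.1 (by linarith [hy.2])]
  have h_inner_meas : MeasurableSet innerShell :=
    ((isOpen_lt continuous_const continuous_norm).inter
      (isOpen_lt continuous_norm continuous_const)).measurableSet
  have h_outer_meas : MeasurableSet outerShell :=
    ((isOpen_lt continuous_const continuous_norm).inter
      (isOpen_lt continuous_norm continuous_const)).measurableSet
  have h_sub : innerShell ⊆ Metric.closedBall 0 r := fun x hx => by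
    simpa using hx.2.le
  have h_int : IntegrableOn (fun x => ‖fderiv ℝ w x‖ ^ 2) innerShell := by
    have hc : Continuous fun x => ‖fderiv ℝ w x‖ ^ 2 :=
      ((hw.continuous_fderiv one_ne_zero).norm.pow 2)
    exact (hc.continuousOn.integrableOn_compact (isCompact_closedBall 0 r)).mono_set h_sub
  have h_fderiv_within : ∀ x ∈ innerShell,
      HasFDerivWithinAt φ (radialReflectionDeriv r x) innerShell x :=
    fun x hx => (h_deriv (ne_zero hx.1)).hasFDerivWithinAt
  have h_det : ∀ x ∈ innerShell, |(radialReflectionDeriv r x).det| = (2 * r / ‖x‖ - 1) ^ 2 := by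
    intro x hx
    rw [det_radialReflectionDeriv (by simp) (ne_zero hx.1) (by linarith [hx.2]), abs_neg,
      abs_of_nonneg (sq_nonneg _)]
  have h_coef : ∀ x ∈ innerShell, (2 * r / ‖x‖ - 1) ^ 2 ≤ ((r + δ) / (r - δ)) ^ 2 := by
    intro x hx
    have hs : 0 < ‖x‖ := norm_pos_iff.2 (ne_zero hx.1)
    have hd : 0 < r - δ := sub_pos.2 hδr
    have h0 : 0 ≤ 2 * r / ‖x‖ - 1 := by
      rw [sub_nonneg, le_div_iff₀ hs]
      linarith [hx.2]
    have h1 : 2 * r / ‖x‖ ≤ 2 * r / (r - δ) := by gcongr; exact hx.1.le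
    have h2 : (r + δ) / (r - δ) = 2 * r / (r - δ) - 1 := by field_simp; ring
    rw [h2]
    gcongr
  have h_int_det : IntegrableOn
      (fun x => |(radialReflectionDeriv r x).det| • ‖fderiv ℝ w (φ (φ x))‖ ^ 2) innerShell := by
    refine IntegrableOn.congr_fun (f := fun x => (2 * r / ‖x‖ - 1) ^ 2 * ‖fderiv ℝ w x‖ ^ 2) ?_
      (fun x hx => ?_) h_inner_meas
    · refine (h_int.const_mul (((r + δ) / (r - δ)) ^ 2)).mono' ?_ ?_
      · exact (by fun_prop : Measurable fun x : EuclideanSpace ℝ (Fin 3) =>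
          (2 * r / ‖x‖ - 1) ^ 2).aestronglyMeasurable.mul h_int.aestronglyMeasurable
      · refine (ae_restrict_iff' h_inner_meas).2 (ae_of_all _ fun x hx => ?_)
        rw [Real.norm_of_nonneg (by positivity)]
        gcongr ?_ * _
        exact h_coef x hx
    · simp only [h_invol hx.1 (by linarith [hx.2] : ‖x‖ < r + δ), h_det x hx, smul_eq_mul]
  have h_int_outer : IntegrableOn (fun x => ‖fderiv ℝ w (φ x)‖ ^ 2) outerShell := by
    rw [← h_image, integrableOn_image_iff_integrableOn_abs_det_fderiv_smul volume h_inner_meas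
      h_fderiv_within h_inj]
    exact h_int_det
  have h_chain : ∀ x ∈ outerShell, ‖fderiv ℝ (w ∘ φ) x‖ ^ 2 ≤ ‖fderiv ℝ w (φ x)‖ ^ 2 := by
    intro x hx
    have hx0 : x ≠ 0 := norm_pos_iff.1 (hr.trans hx.1)
    have hcomp := ((hw.differentiable one_ne_zero).differentiableAt (x := φ x)).hasFDerivAt.comp x
      (h_deriv hx0)
    rw [hcomp.fderiv]
    gcongr
    refine (ContinuousLinearMap.opNorm_comp_le _ _).trans ?_
    exact mul_le_of_le_one_right (norm_nonneg _) (norm_radialReflectionDeriv_le_one hr hx.1.le)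
  calc ∫ x in outerShell, ‖fderiv ℝ (w ∘ φ) x‖ ^ 2
      ≤ ∫ x in outerShell, ‖fderiv ℝ w (φ x)‖ ^ 2 :=
        integral_mono_of_nonneg (ae_of_all _ fun x => sq_nonneg _) h_int_outer
          ((ae_restrict_iff' h_outer_meas).2 (ae_of_all _ h_chain))
    _ = ∫ x in innerShell, |(radialReflectionDeriv r x).det| • ‖fderiv ℝ w (φ (φ x))‖ ^ 2 := by
        rw [← h_image, integral_image_eq_integral_abs_det_fderiv_smul volume h_inner_meas
          h_fderiv_within h_inj]
    _ ≤ ∫ x in innerShell, ((r + δ) / (r - δ)) ^ 2 * ‖fderiv ℝ w x‖ ^ 2 := by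
        refine setIntegral_mono_on h_int_det (h_int.const_mul _) h_inner_meas fun x hx => ?_
        rw [h_invol hx.1 (by linarith [hx.2]), h_det x hx, smul_eq_mul]
        gcongr ?_ * _
        exact h_coef x hx
    _ = _ := integral_const_mul _ _
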